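/- The kernel K(x,y,t) converges to the two-dimensional Dirac delta distribution as t → 0⁺; that is, for every bounded continuous function f on ℝ², ∬_{ℝ²} K(x,y,t) f(x,y) dx dy → f(0,0) as t → 0⁺. -/

import Mathlib

open MeasureTheory Real Filter Topology

noncomputable def Ksym (ν t : ℝ) (k : ℝ × ℝ) : ℝ :=
  Real.exp (-(t/2) * (k.1^2 / ((1-ν) * Real.sqrt (k.1^2 + k.2^2)) +
    k.2^2 / Real.sqrt (k.1^2 + k.2^2)))

noncomputable def Kdis (ν x y t : ℝ) : ℂ :=
  (1/(2*Real.pi)^2 : ℂ) *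
    ∫ k : ℝ × ℝ, (Ksym ν t k : ℂ) * Complex.exp (Complex.I * ((k.1*x + k.2*y : ℝ) : ℂ))


noncomputable section

/-- The angular profile of the symbol, `-log (Ksym ν 1 (cos θ, sin θ))` for `b = 1 / (1 - ν)`. -/
def angularProfile (b θ : ℝ) : ℝ := (b * Real.cos θ ^ 2 + Real.sin θ ^ 2) / 2

/-- The complex rate of the radial exponential appearing in the Fourier integral. -/
def angularRate (b x y θ : ℝ) : ℂ :=
  (angularProfile b θ : ℂ) - Complex.I * ((x * Real.cos θ + y * Real.sin θ : ℝ) : ℂ)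

lemma half_le_angularProfile {b : ℝ} (hb : 1 ≤ b) (θ : ℝ) : 1 / 2 ≤ angularProfile b θ := by
  unfold angularProfile
  nlinarith [Real.sin_sq_add_cos_sq θ, sq_nonneg (Real.cos θ)]

@[simp] lemma angularRate_re (b x y θ : ℝ) : (angularRate b x y θ).re = angularProfile b θ := by
  simp [angularRate, -Complex.ofReal_add, -Complex.ofReal_mul]

@[simp] lemma angularRate_im (b x y θ : ℝ) :
    (angularRate b x y θ).im = -(x * Real.cos θ + y * Real.sin θ) := by
  simp [angularRate, -Complex.ofReal_add, -Complex.ofReal_mul]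

lemma half_le_norm_angularRate {b : ℝ} (hb : 1 ≤ b) (x y θ : ℝ) :
    1 / 2 ≤ ‖angularRate b x y θ‖ := by
  have := Complex.re_le_norm (angularRate b x y θ)
  rw [angularRate_re] at this
  exact (half_le_angularProfile hb θ).trans this

lemma angularRate_ne_zero {b : ℝ} (hb : 1 ≤ b) (x y θ : ℝ) : angularRate b x y θ ≠ 0 := by
  have := half_le_norm_angularRate hb x y θ
  intro h
  rw [h, norm_zero] at this
  norm_num at this

@[fun_prop]
lemma continuous_angularRate (b x y : ℝ) : Continuous (angularRate b x y) := by
  unfold angularRate angularProfile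
  fun_prop

lemma hasDerivAt_angularRate (b x y θ : ℝ) :
    HasDerivAt (angularRate b x y)
      (((1 - b) * Real.cos θ * Real.sin θ : ℝ) -
        Complex.I * ((-x * Real.sin θ + y * Real.cos θ : ℝ) : ℂ)) θ := by
  have hc := Real.hasDerivAt_cos θ
  have hs := Real.hasDerivAt_sin θ
  have h1 : HasDerivAt (angularProfile b) ((1 - b) * Real.cos θ * Real.sin θ) θ := by
    refine ((((hc.pow 2).const_mul b).add (hs.pow 2)).div_const 2).congr_deriv ?_
    simp
    ring
  have h2 : HasDerivAt (fun θ => x * Real.cos θ + y * Real.sin θ)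
      (-x * Real.sin θ + y * Real.cos θ) θ := by
    refine ((hc.const_mul x).add (hs.const_mul y)).congr_deriv ?_
    ring
  exact h1.ofReal_comp.sub (h2.ofReal_comp.const_mul Complex.I)

/-- Integration by parts over the circle: the angular integral gains a factor `1 / R²`. -/
lemma sq_mul_integral_inv_angularRate_sq {b : ℝ} (hb : 1 ≤ b) (x y : ℝ) :
    ((x ^ 2 + y ^ 2 : ℝ) : ℂ) * ∫ θ in (-π)..π, (angularRate b x y θ ^ 2)⁻¹ =
      ∫ θ in (-π)..π,
        (((angularProfile b θ + (1 - b) * (Real.cos θ ^ 2 - Real.sin θ ^ 2) : ℝ) : ℂ) /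
            angularRate b x y θ -
          ((angularProfile b θ ^ 2 + ((1 - b) * Real.cos θ * Real.sin θ) ^ 2 : ℝ) : ℂ) /
            angularRate b x y θ ^ 2) := by
  have hne := angularRate_ne_zero hb x y
  have hne2 : ∀ θ, angularRate b x y θ ^ 2 ≠ 0 := fun θ => pow_ne_zero 2 (hne θ)
  have hcp : Continuous (angularProfile b) := by unfold angularProfile; fun_prop
  let F : ℝ → ℂ := fun θ => -(((1 - b) * Real.cos θ * Real.sin θ : ℝ) +
        Complex.I * ((-x * Real.sin θ + y * Real.cos θ : ℝ) : ℂ)) / angularRate b x y θ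
  have hF : ∀ θ, HasDerivAt F
      (((x ^ 2 + y ^ 2 : ℝ) : ℂ) * (angularRate b x y θ ^ 2)⁻¹ -
        (((angularProfile b θ + (1 - b) * (Real.cos θ ^ 2 - Real.sin θ ^ 2) : ℝ) : ℂ) /
            angularRate b x y θ -
          ((angularProfile b θ ^ 2 + ((1 - b) * Real.cos θ * Real.sin θ) ^ 2 : ℝ) : ℂ) /
            angularRate b x y θ ^ 2)) θ := by
    intro θ
    have hc := Real.hasDerivAt_cos θ
    have hs := Real.hasDerivAt_sin θ
    have h1 : HasDerivAt (fun θ => (1 - b) * Real.cos θ * Real.sin θ)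
        ((1 - b) * (Real.cos θ ^ 2 - Real.sin θ ^ 2)) θ := by
      refine ((hc.const_mul (1 - b)).mul hs).congr_deriv ?_
      ring
    have h2 : HasDerivAt (fun θ => -x * Real.sin θ + y * Real.cos θ)
        (-(x * Real.cos θ + y * Real.sin θ)) θ := by
      refine ((hs.const_mul (-x)).add (hc.const_mul y)).congr_deriv ?_
      ring
    refine ((h1.ofReal_comp.add (h2.ofReal_comp.const_mul Complex.I)).neg.div
      (hasDerivAt_angularRate b x y θ) (hne θ)).congr_deriv ?_
    have hp : (angularProfile b θ : ℂ) = angularRate b x y θ +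
        Complex.I * ((x * Real.cos θ + y * Real.sin θ : ℝ) : ℂ) := by
      simp [angularRate]
    have hcs : (Complex.sin θ) ^ 2 + Complex.cos θ ^ 2 = 1 := Complex.sin_sq_add_cos_sq _
    have h0 := hne θ
    push_cast at hp ⊢
    rw [hp]
    generalize angularRate b x y θ = D at *
    field_simp
    simp only [Pi.add_apply, Pi.neg_apply]
    linear_combination (x ^ 2 + y ^ 2 : ℂ) * hcs -
      (Complex.cos θ ^ 2 + Complex.sin θ ^ 2) * (x ^ 2 + y ^ 2 : ℂ) * Complex.I_sq
  have hi1 : IntervalIntegrable (fun θ => ((x ^ 2 + y ^ 2 : ℝ) : ℂ) *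
      (angularRate b x y θ ^ 2)⁻¹) volume (-π) π := by
    refine Continuous.intervalIntegrable ?_ _ _
    exact continuous_const.mul (((continuous_angularRate b x y).pow 2).inv₀ hne2)
  have hi2 : IntervalIntegrable (fun θ =>
      ((angularProfile b θ + (1 - b) * (Real.cos θ ^ 2 - Real.sin θ ^ 2) : ℝ) : ℂ) /
            angularRate b x y θ -
          ((angularProfile b θ ^ 2 + ((1 - b) * Real.cos θ * Real.sin θ) ^ 2 : ℝ) : ℂ) /
            angularRate b x y θ ^ 2) volume (-π) π := by
    refine Continuous.intervalIntegrable (Continuous.sub ?_ ?_) _ _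
    · exact Continuous.div (by fun_prop) (by fun_prop) hne
    · exact Continuous.div (by fun_prop) (by fun_prop) hne2
  rw [← intervalIntegral.integral_const_mul, ← sub_eq_zero,
    ← intervalIntegral.integral_sub hi1 hi2,
    intervalIntegral.integral_eq_sub_of_hasDerivAt (fun θ _ => hF θ) (hi1.sub hi2)]
  simp [F, angularRate, angularProfile]

lemma integral_inv_sqrt_sin_le {R : ℝ} (hR : 0 < R) (c : ℝ) :
    ∫ θ in (-π)..π, (√(1 / 4 + (R * Real.sin (θ + c)) ^ 2))⁻¹ ≤
      4 * (√2 * (∫ s in (0 : ℝ)..(π / 2), s ^ (-(1 / 2) : ℝ)) * R ^ (-(1 / 2) : ℝ)) := by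
  let B : ℝ → ℝ := fun s => (√(1 / 4 + (R * Real.sin s) ^ 2))⁻¹
  have hpos : ∀ s, 0 < 1 / 4 + (R * Real.sin s) ^ 2 := fun s => by positivity
  have hBc : Continuous B := by
    refine Continuous.inv₀ (by fun_prop) fun s => ?_
    exact (Real.sqrt_pos.2 (hpos s)).ne'
  have hBi : ∀ a b, IntervalIntegrable B volume a b := fun a b => hBc.intervalIntegrable a b
  have hper : Function.Periodic B π := by
    intro s
    simp [B, Real.sin_add_pi]
  have hneg : ∀ s, B (-s) = B s := by
    intro s
    simp [B]
  have hhalf : ∫ s in (-(π / 2))..(π / 2), B s = 2 * ∫ s in (0 : ℝ)..(π / 2), B s := by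
    rw [← intervalIntegral.integral_add_adjacent_intervals (hBi _ 0) (hBi 0 _)]
    have := intervalIntegral.integral_comp_neg (a := 0) (b := π / 2) B
    simp only [hneg, neg_zero] at this
    rw [← this]
    ring
  have hp : ∀ a, ∫ s in a..(a + π), B s = 2 * ∫ s in (0 : ℝ)..(π / 2), B s := by
    intro a
    rw [hper.intervalIntegral_add_eq a (-(π / 2)), ← hhalf]
    congr 1
    ring
  have htot : ∫ θ in (-π)..π, B (θ + c) = 4 * ∫ s in (0 : ℝ)..(π / 2), B s := by
    rw [intervalIntegral.integral_comp_add_right,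
      ← intervalIntegral.integral_add_adjacent_intervals (hBi _ (-π + c + π)) (hBi _ _), hp]
    have : π + c = (-π + c + π) + π := by ring
    rw [this, hp]
    ring
  refine (le_of_eq htot).trans ?_
  gcongr
  have hint : IntervalIntegrable (fun s : ℝ => s ^ (-(1 / 2) : ℝ)) volume 0 (π / 2) :=
    intervalIntegral.intervalIntegrable_rpow' (by norm_num)
  have : √2 * (∫ s in (0 : ℝ)..(π / 2), s ^ (-(1 / 2) : ℝ)) * R ^ (-(1 / 2) : ℝ) =
      ∫ s in (0 : ℝ)..(π / 2), √2 * R ^ (-(1 / 2) : ℝ) * s ^ (-(1 / 2) : ℝ) := by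
    rw [intervalIntegral.integral_const_mul]
    ring
  rw [this]
  refine intervalIntegral.integral_mono_on_of_le_Ioo (by positivity) (hBi _ _)
    (hint.const_mul _) fun s hs => ?_
  have hs0 : 0 < s := hs.1
  have hsin : s / 2 ≤ Real.sin s := by
    refine le_trans ?_ (Real.mul_le_sin hs0.le hs.2.le)
    have : 1 / 2 ≤ 2 / π := by
      rw [div_le_div_iff₀ (by norm_num) Real.pi_pos]
      linarith [Real.pi_le_four]
    nlinarith
  have hle : R * s / 2 ≤ 1 / 4 + (R * Real.sin s) ^ 2 := by
    have h1 : R * (s / 2) ≤ R * Real.sin s := by gcongr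
    have h2 : (R * (s / 2)) ^ 2 ≤ (R * Real.sin s) ^ 2 := by gcongr
    nlinarith [sq_nonneg (1 - R * s)]
  have heq : √2 * R ^ (-(1 / 2) : ℝ) * s ^ (-(1 / 2) : ℝ) = (√(R * s / 2))⁻¹ := by
    rw [Real.rpow_neg hR.le, Real.rpow_neg hs0.le, ← Real.sqrt_eq_rpow, ← Real.sqrt_eq_rpow,
      Real.sqrt_div (by positivity), Real.sqrt_mul hR.le, inv_div]
    field_simp
  rw [heq]
  exact inv_anti₀ (Real.sqrt_pos.2 (by positivity)) (Real.sqrt_le_sqrt hle)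

lemma integral_norm_inv_angularRate_le {b : ℝ} (hb : 1 ≤ b) {x y : ℝ} (hR : 0 < √(x ^ 2 + y ^ 2)) :
    ∫ θ in (-π)..π, ‖angularRate b x y θ‖⁻¹ ≤
      4 * (√2 * (∫ s in (0 : ℝ)..(π / 2), s ^ (-(1 / 2) : ℝ)) *
        √(x ^ 2 + y ^ 2) ^ (-(1 / 2) : ℝ)) := by
  have hz : ‖(⟨x, y⟩ : ℂ)‖ = √(x ^ 2 + y ^ 2) := by
    rw [Complex.norm_def, Complex.normSq_mk]
    ring_nf
  have hx := Complex.norm_mul_cos_arg (⟨x, y⟩ : ℂ)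
  have hy := Complex.norm_mul_sin_arg (⟨x, y⟩ : ℂ)
  rw [hz] at hx hy
  simp only at hx hy
  set α := Complex.arg (⟨x, y⟩ : ℂ)
  set R := √(x ^ 2 + y ^ 2)
  refine le_trans ?_ (integral_inv_sqrt_sin_le hR (π / 2 - α))
  have hpos : ∀ s, 0 < √(1 / 4 + (R * Real.sin (s + (π / 2 - α))) ^ 2) := fun s =>
    Real.sqrt_pos.2 (by positivity)
  refine intervalIntegral.integral_mono_on (by linarith [Real.pi_pos])
    (Continuous.intervalIntegrable ?_ _ _) (Continuous.intervalIntegrable ?_ _ _) fun θ _ => ?_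
  · exact (continuous_angularRate b x y).norm.inv₀ fun θ =>
      norm_ne_zero_iff.2 (angularRate_ne_zero hb x y θ)
  · exact Continuous.inv₀ (by fun_prop) fun s => (hpos s).ne'
  · refine inv_anti₀ (hpos θ) ?_
    rw [Complex.norm_def, Complex.normSq_apply, angularRate_re, angularRate_im]
    refine Real.sqrt_le_sqrt ?_
    have hu : R * Real.sin (θ + (π / 2 - α)) = x * Real.cos θ + y * Real.sin θ := by
      rw [show θ + (π / 2 - α) = (θ - α) + π / 2 by ring, Real.sin_add_pi_div_two,
        Real.cos_sub, ← hx, ← hy]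
      ring
    rw [hu]
    nlinarith [half_le_angularProfile hb θ]

lemma norm_le_sqrt_sq_add_sq (k : ℝ × ℝ) : ‖k‖ ≤ √(k.1 ^ 2 + k.2 ^ 2) := by
  rw [Prod.norm_def, max_le_iff, Real.norm_eq_abs, Real.norm_eq_abs]
  exact ⟨Real.abs_le_sqrt (by nlinarith), Real.abs_le_sqrt (by nlinarith)⟩

/-- Decay of the angular integral: it is `O((1 + R) ^ (-5/2))`. -/
lemma exists_norm_integral_inv_angularRate_sq_le {b : ℝ} (hb : 1 ≤ b) :
    ∃ C : ℝ, ∀ p : ℝ × ℝ, ‖∫ θ in (-π)..π, (angularRate b p.1 p.2 θ ^ 2)⁻¹‖ ≤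
      C * (1 + ‖p‖) ^ (-(5 / 2) : ℝ) := by
  set J := ∫ s in (0 : ℝ)..(π / 2), s ^ (-(1 / 2) : ℝ) with hJ
  have hJ0 : 0 ≤ J := intervalIntegral.integral_nonneg (by positivity) fun s hs =>
    Real.rpow_nonneg hs.1 _
  set A := (2 * b + 4 * b ^ 2) * (4 * (√2 * J)) with hA
  have hA0 : 0 ≤ A := by positivity
  have hsmall : ∀ x y : ℝ, ‖∫ θ in (-π)..π, (angularRate b x y θ ^ 2)⁻¹‖ ≤ 8 * π := by
    intro x y
    refine (intervalIntegral.norm_integral_le_of_norm_le_const (C := 4) fun θ _ => ?_).trans ?_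
    · rw [norm_inv, norm_pow]
      have := half_le_norm_angularRate hb x y θ
      rw [inv_le_comm₀ (by positivity) (by norm_num)]
      nlinarith
    · rw [show π - -π = 2 * π by ring, abs_of_pos (by positivity)]
      linarith
  have hlarge : ∀ x y : ℝ, 0 < √(x ^ 2 + y ^ 2) →
      √(x ^ 2 + y ^ 2) ^ 2 * ‖∫ θ in (-π)..π, (angularRate b x y θ ^ 2)⁻¹‖ ≤
        A * √(x ^ 2 + y ^ 2) ^ (-(1 / 2) : ℝ) := by
    intro x y hR
    have hsq : √(x ^ 2 + y ^ 2) ^ 2 = x ^ 2 + y ^ 2 := Real.sq_sqrt (by positivity)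
    have hnorm : √(x ^ 2 + y ^ 2) ^ 2 * ‖∫ θ in (-π)..π, (angularRate b x y θ ^ 2)⁻¹‖ =
        ‖((x ^ 2 + y ^ 2 : ℝ) : ℂ) * ∫ θ in (-π)..π, (angularRate b x y θ ^ 2)⁻¹‖ := by
      rw [hsq, norm_mul, Complex.norm_real, Real.norm_of_nonneg (by positivity)]
    rw [hnorm, sq_mul_integral_inv_angularRate_sq hb]
    have hcont : Continuous fun θ => (2 * b + 4 * b ^ 2) * ‖angularRate b x y θ‖⁻¹ :=
      continuous_const.mul ((continuous_angularRate b x y).norm.inv₀ fun θ =>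
        norm_ne_zero_iff.2 (angularRate_ne_zero hb x y θ))
    refine (intervalIntegral.norm_integral_le_of_norm_le (by linarith [Real.pi_pos])
      (ae_of_all _ fun θ _ => ?_) (hcont.intervalIntegrable _ _)).trans ?_
    · have hD := half_le_norm_angularRate hb x y θ
      have hD0 : 0 < ‖angularRate b x y θ‖ := by linarith
      have hcs := Real.sin_sq_add_cos_sq θ
      have hc0 := sq_nonneg (Real.cos θ)
      have hs0 := sq_nonneg (Real.sin θ)
      have hp0 : 0 ≤ angularProfile b θ := by linarith [half_le_angularProfile hb θ]
      have hp1 : angularProfile b θ ≤ b := by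
        unfold angularProfile
        nlinarith
      have h1 : |angularProfile b θ + (1 - b) * (Real.cos θ ^ 2 - Real.sin θ ^ 2)| ≤ 2 * b := by
        rw [abs_le]
        constructor <;> nlinarith
      have h2 : |angularProfile b θ ^ 2 + ((1 - b) * Real.cos θ * Real.sin θ) ^ 2| ≤
          2 * b ^ 2 := by
        rw [abs_of_nonneg (by positivity)]
        have e1 : angularProfile b θ ^ 2 ≤ b ^ 2 := by gcongr
        have e2 : (Real.cos θ * Real.sin θ) ^ 2 ≤ 1 := by
          rw [mul_pow]
          nlinarith
        have e3 : (1 - b) ^ 2 ≤ b ^ 2 := by nlinarith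
        have e4 : ((1 - b) * Real.cos θ * Real.sin θ) ^ 2 =
          (1 - b) ^ 2 * (Real.cos θ * Real.sin θ) ^ 2 := by ring
        nlinarith [mul_le_mul e3 e2 (sq_nonneg _) (sq_nonneg b)]
      refine (norm_sub_le _ _).trans ?_
      rw [norm_div, norm_div, norm_pow, Complex.norm_real, Complex.norm_real, Real.norm_eq_abs,
        Real.norm_eq_abs, add_mul]
      refine add_le_add ?_ ?_
      · rw [div_eq_mul_inv]
        gcongr
      · rw [← div_eq_mul_inv, div_le_div_iff₀ (by positivity) hD0]
        calc _ ≤ 2 * b ^ 2 * ‖angularRate b x y θ‖ := by gcongr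
          _ = 4 * b ^ 2 * (1 / 2 * ‖angularRate b x y θ‖) := by ring
          _ ≤ 4 * b ^ 2 * (‖angularRate b x y θ‖ * ‖angularRate b x y θ‖) := by gcongr
          _ = _ := by ring
    · rw [intervalIntegral.integral_const_mul]
      calc _ ≤ (2 * b + 4 * b ^ 2) * (4 * (√2 * J * √(x ^ 2 + y ^ 2) ^ (-(1 / 2) : ℝ))) := by
            gcongr
            exact integral_norm_inv_angularRate_le hb hR
        _ = _ := by rw [hA]; ring
  refine ⟨2 ^ (5 / 2 : ℝ) * (8 * π + A), fun p => ?_⟩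
  obtain ⟨x, y⟩ := p
  have hle : ‖(x, y)‖ ≤ √(x ^ 2 + y ^ 2) := norm_le_sqrt_sq_add_sq (x, y)
  have key : ∀ M r : ℝ, 0 ≤ M → 0 < r → 1 + ‖(x, y)‖ ≤ 2 * r → M ≤ 8 * π + A →
      M * r ^ (-(5 / 2) : ℝ) ≤ 2 ^ (5 / 2 : ℝ) * (8 * π + A) * (1 + ‖(x, y)‖) ^ (-(5 / 2) : ℝ) := by
    intro M r hM hr hr2 hM2
    have h1 : (2 * r) ^ (-(5 / 2) : ℝ) ≤ (1 + ‖(x, y)‖) ^ (-(5 / 2) : ℝ) :=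
      Real.rpow_le_rpow_of_nonpos (by positivity) hr2 (by norm_num)
    rw [Real.mul_rpow (by norm_num) hr.le] at h1
    have h2 : (2 : ℝ) ^ (5 / 2 : ℝ) * 2 ^ (-(5 / 2) : ℝ) = 1 := by
      rw [← Real.rpow_add (by norm_num)]
      norm_num
    calc M * r ^ (-(5 / 2) : ℝ) =
        2 ^ (5 / 2 : ℝ) * M * (2 ^ (-(5 / 2) : ℝ) * r ^ (-(5 / 2) : ℝ)) := by
          linear_combination (-M * r ^ (-(5 / 2) : ℝ)) * h2
      _ ≤ _ := by gcongr
  rcases le_total (√(x ^ 2 + y ^ 2)) 1 with h | h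
  · have := key (8 * π) 1 (by positivity) one_pos (by linarith) (by linarith)
    rw [Real.one_rpow, mul_one] at this
    exact (hsmall x y).trans this
  · have hR : 0 < √(x ^ 2 + y ^ 2) := by linarith
    refine le_trans ?_ (key A _ hA0 hR (by linarith) (by linarith [Real.pi_pos]))
    have h3 := hlarge x y hR
    have h4 : √(x ^ 2 + y ^ 2) ^ (-(1 / 2) : ℝ) =
        √(x ^ 2 + y ^ 2) ^ 2 * √(x ^ 2 + y ^ 2) ^ (-(5 / 2) : ℝ) := by
      rw [← Real.rpow_natCast (√(x ^ 2 + y ^ 2)) 2, ← Real.rpow_add hR]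
      norm_num
    rw [h4] at h3
    have h5 : 0 < √(x ^ 2 + y ^ 2) ^ 2 := by positivity
    refine le_of_mul_le_mul_left (h3.trans_eq ?_) h5
    ring

lemma integrableOn_mul_exp_neg_mul_Ioi {c : ℝ} (hc : 0 < c) :
    IntegrableOn (fun r : ℝ => r * Real.exp (-(c * r))) (Set.Ioi 0) := by
  have := integrableOn_rpow_mul_exp_neg_mul_rpow (s := 1) (p := 1) (b := c) (by norm_num)
    (by norm_num) hc
  simpa using this

lemma norm_ofReal_mul_cexp_neg_mul {D : ℂ} {r : ℝ} (hr : 0 ≤ r) :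
    ‖(r : ℂ) * Complex.exp (-(r * D))‖ = r * Real.exp (-(D.re * r)) := by
  rw [norm_mul, Complex.norm_real, Real.norm_of_nonneg hr, Complex.norm_exp]
  simp [mul_comm]

lemma integral_ofReal_mul_cexp_neg_mul_Ioi {D : ℂ} (hD : 0 < D.re) :
    ∫ r in Set.Ioi (0 : ℝ), (r : ℂ) * Complex.exp (-(r * D)) = (D ^ 2)⁻¹ := by
  have hD0 : D ≠ 0 := by
    rintro rfl
    simp at hD
  have hder : ∀ r : ℝ, HasDerivAt
      (fun r : ℝ => -((r : ℂ) * Complex.exp (-(r * D))) / D - Complex.exp (-(r * D)) / D ^ 2)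
      ((r : ℂ) * Complex.exp (-(r * D))) r := by
    intro r
    have h1 : HasDerivAt (fun r : ℝ => (r : ℂ)) 1 r := Complex.ofRealCLM.hasDerivAt
    have h2 : HasDerivAt (fun r : ℝ => Complex.exp (-(r * D)))
        (Complex.exp (-(r * D)) * -(1 * D)) r := (h1.mul_const D).neg.cexp
    refine (((h1.mul h2).neg.div_const D).sub (h2.div_const (D ^ 2))).congr_deriv ?_
    field_simp
    ring
  have hint : IntegrableOn (fun r : ℝ => (r : ℂ) * Complex.exp (-(r * D))) (Set.Ioi 0) := by
    refine (integrableOn_mul_exp_neg_mul_Ioi hD).mono' (by fun_prop) ?_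
    filter_upwards [ae_restrict_mem measurableSet_Ioi] with r hr
    exact (norm_ofReal_mul_cexp_neg_mul (le_of_lt hr)).le
  have hlin : Tendsto (fun r : ℝ => D.re * r) atTop atTop := tendsto_id.const_mul_atTop hD
  have hexp : Tendsto (fun r : ℝ => Complex.exp (-(r * D))) atTop (𝓝 0) := by
    rw [tendsto_zero_iff_norm_tendsto_zero]
    refine (Real.tendsto_exp_neg_atTop_nhds_zero.comp hlin).congr fun r => ?_
    simp [Complex.norm_exp, mul_comm]
  have hmul : Tendsto (fun r : ℝ => (r : ℂ) * Complex.exp (-(r * D))) atTop (𝓝 0) := by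
    rw [tendsto_zero_iff_norm_tendsto_zero]
    have h := ((Real.tendsto_pow_mul_exp_neg_atTop_nhds_zero 1).comp hlin).const_mul (D.re)⁻¹
    rw [mul_zero] at h
    refine h.congr' ?_
    filter_upwards [eventually_ge_atTop 0] with r hr
    rw [norm_ofReal_mul_cexp_neg_mul hr]
    simp only [Function.comp_apply, pow_one]
    field_simp
  have hlim := (hmul.neg.div_const D).sub (hexp.div_const (D ^ 2))
  rw [integral_Ioi_of_hasDerivAt_of_tendsto' (fun r _ => hder r) hint hlim]
  simp

lemma Ksym_polar {ν : ℝ} {r : ℝ} (hr : 0 < r) (θ : ℝ) :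
    Ksym ν 1 (r * Real.cos θ, r * Real.sin θ) =
      Real.exp (-(r * angularProfile (1 / (1 - ν)) θ)) := by
  have hs : √((r * Real.cos θ) ^ 2 + (r * Real.sin θ) ^ 2) = r := by
    rw [show (r * Real.cos θ) ^ 2 + (r * Real.sin θ) ^ 2 =
      r ^ 2 * (Real.sin θ ^ 2 + Real.cos θ ^ 2) by ring, Real.sin_sq_add_cos_sq, mul_one,
      Real.sqrt_sq hr.le]
  unfold Ksym angularProfile
  simp only [hs]
  congr 1
  rw [div_mul_eq_div_div_swap]
  field_simp

lemma Kdis_one_eq {ν : ℝ} (hν0 : 0 ≤ ν) (hν1 : ν < 1) (x y : ℝ) :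
    Kdis ν x y 1 = (1 / (2 * Real.pi) ^ 2 : ℂ) *
      ∫ θ in (-π)..π, (angularRate (1 / (1 - ν)) x y θ ^ 2)⁻¹ := by
  have hb : 1 ≤ 1 / (1 - ν) := by
    rw [le_div_iff₀ (by linarith)]
    linarith
  set b := 1 / (1 - ν) with hbdef
  unfold Kdis
  congr 1
  rw [← integral_comp_polarCoord_symm]
  have hpol : ∀ p ∈ polarCoord.target, p.1 • ((Ksym ν 1 (polarCoord.symm p) : ℂ) *
      Complex.exp (Complex.I *
        (((polarCoord.symm p).1 * x + (polarCoord.symm p).2 * y : ℝ) : ℂ))) =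
      (p.1 : ℂ) * Complex.exp (-(p.1 * angularRate b x y p.2)) := by
    rintro ⟨r, θ⟩ hp
    have hr : 0 < r := hp.1
    simp only [polarCoord_symm_apply]
    rw [Ksym_polar hr, Complex.real_smul, Complex.ofReal_exp, ← Complex.exp_add]
    congr 2
    simp only [angularRate, ← hbdef]
    push_cast
    ring
  rw [setIntegral_congr_fun polarCoord.open_target.measurableSet hpol, polarCoord_target,
    Measure.volume_eq_prod]
  have hint : Integrable (fun p : ℝ × ℝ =>
      (p.1 : ℂ) * Complex.exp (-(p.1 * angularRate b x y p.2)))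
      ((volume.restrict (Set.Ioi 0)).prod (volume.restrict (Set.Ioo (-π) π))) := by
    have hone : Integrable (fun _ : ℝ => (1 : ℝ)) (volume.restrict (Set.Ioo (-π) π)) :=
      integrable_const _
    refine ((integrableOn_mul_exp_neg_mul_Ioi (c := 1 / 2) (by norm_num)).mul_prod hone).mono'
      (by fun_prop) ?_
    rw [Measure.prod_restrict]
    filter_upwards [ae_restrict_mem (measurableSet_Ioi.prod measurableSet_Ioo)] with p hp
    have hr : 0 < p.1 := hp.1
    rw [norm_ofReal_mul_cexp_neg_mul hr.le, angularRate_re, mul_one]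
    have := half_le_angularProfile hb p.2
    gcongr
  rw [← Measure.prod_restrict, integral_prod_symm _ hint,
    intervalIntegral.integral_of_le (by linarith [Real.pi_pos]), integral_Ioc_eq_integral_Ioo]
  refine integral_congr_ae (ae_of_all _ fun θ => ?_)
  refine integral_ofReal_mul_cexp_neg_mul_Ioi (D := angularRate b x y θ) ?_
  rw [angularRate_re]
  linarith [half_le_angularProfile hb θ]

@[fun_prop]
lemma measurable_Ksym (ν t : ℝ) : Measurable (Ksym ν t) := by
  unfold Ksym
  fun_prop

lemma integrable_Kdis_one {ν : ℝ} (hν0 : 0 ≤ ν) (hν1 : ν < 1) :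
    Integrable fun p : ℝ × ℝ => Kdis ν p.1 p.2 1 := by
  have hb : 1 ≤ 1 / (1 - ν) := by
    rw [le_div_iff₀ (by linarith)]
    linarith
  obtain ⟨C, hC⟩ := exists_norm_integral_inv_angularRate_sq_le hb
  have hint : Integrable (fun p : ℝ × ℝ =>
      ‖(1 / (2 * Real.pi) ^ 2 : ℂ)‖ * (C * (1 + ‖p‖) ^ (-(5 / 2) : ℝ))) := by
    refine ((integrable_one_add_norm ?_).const_mul C).const_mul _
    norm_num
  refine hint.mono' ?_ (ae_of_all _ fun p => ?_)
  · unfold Kdis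
    refine AEStronglyMeasurable.const_mul (StronglyMeasurable.aestronglyMeasurable ?_) _
    refine StronglyMeasurable.integral_prod_right (f := fun (p k : ℝ × ℝ) => (Ksym ν 1 k : ℂ) *
      Complex.exp (Complex.I * ((k.1 * p.1 + k.2 * p.2 : ℝ) : ℂ))) ?_
    refine Measurable.stronglyMeasurable ?_
    simp only [Function.uncurry_def]
    fun_prop
  · rw [Kdis_one_eq hν0 hν1, norm_mul]
    gcongr
    exact hC p

lemma Ksym_one_le {ν : ℝ} (hν0 : 0 ≤ ν) (hν1 : ν < 1) (k : ℝ × ℝ) :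
    Ksym ν 1 k ≤ Real.exp (-(‖k‖ / 2)) := by
  unfold Ksym
  have hk := norm_le_sqrt_sq_add_sq k
  have hs : (k.1 ^ 2 + k.2 ^ 2) / √(k.1 ^ 2 + k.2 ^ 2) = √(k.1 ^ 2 + k.2 ^ 2) := Real.div_sqrt
  set s := √(k.1 ^ 2 + k.2 ^ 2) with hsdef
  have hs0 : 0 ≤ s := Real.sqrt_nonneg _
  have h1 : k.1 ^ 2 / s ≤ k.1 ^ 2 / ((1 - ν) * s) := by
    rw [div_mul_eq_div_div_swap, le_div_iff₀ (by linarith)]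
    have : 0 ≤ k.1 ^ 2 / s := by positivity
    nlinarith
  rw [add_div] at hs
  rw [Real.exp_le_exp]
  linarith

lemma integrable_Ksym_one {ν : ℝ} (hν0 : 0 ≤ ν) (hν1 : ν < 1) : Integrable (Ksym ν 1) := by
  have hint : Integrable (fun k : ℝ × ℝ => 216 * (1 + ‖k‖) ^ (-3 : ℝ)) :=
    (integrable_one_add_norm (by norm_num)).const_mul _
  refine hint.mono' (measurable_Ksym ν 1).aestronglyMeasurable (ae_of_all _ fun k => ?_)
  rw [Real.norm_of_nonneg (show 0 ≤ Ksym ν 1 k from (Real.exp_pos _).le)]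
  refine (Ksym_one_le hν0 hν1 k).trans ?_
  have h0 := norm_nonneg k
  rw [Real.rpow_neg (by positivity), ← div_eq_mul_inv, Real.exp_neg, inv_eq_one_div,
    div_le_div_iff₀ (Real.exp_pos _) (by positivity)]
  have h1 : 1 + ‖k‖ ≤ 6 * Real.exp (‖k‖ / 6) := by linarith [Real.add_one_le_exp (‖k‖ / 6)]
  have h2 : Real.exp (‖k‖ / 2) = Real.exp (‖k‖ / 6) ^ 3 := by
    rw [← Real.exp_nat_mul]
    congr 1
    push_cast
    ring
  rw [h2, one_mul]
  calc (1 + ‖k‖) ^ (3 : ℝ) = (1 + ‖k‖) ^ 3 := by norm_cast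
    _ ≤ (6 * Real.exp (‖k‖ / 6)) ^ 3 := by gcongr
    _ = _ := by ring

lemma Ksym_zero (ν t : ℝ) : Ksym ν t 0 = 1 := by simp [Ksym]

lemma continuousAt_Ksym_one_zero {ν : ℝ} (hν0 : 0 ≤ ν) (hν1 : ν < 1) :
    ContinuousAt (Ksym ν 1) 0 := by
  have hlow : ∀ k : ℝ × ℝ, Real.exp (-(√(k.1 ^ 2 + k.2 ^ 2) / (1 - ν))) ≤ Ksym ν 1 k := by
    intro k
    unfold Ksym
    have hs : (k.1 ^ 2 + k.2 ^ 2) / √(k.1 ^ 2 + k.2 ^ 2) = √(k.1 ^ 2 + k.2 ^ 2) := Real.div_sqrt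
    set s := √(k.1 ^ 2 + k.2 ^ 2) with hsdef
    have hs0 : 0 ≤ s := Real.sqrt_nonneg _
    have h2 : k.2 ^ 2 / s ≤ k.2 ^ 2 / s / (1 - ν) := by
      rw [le_div_iff₀ (by linarith)]
      have : 0 ≤ k.2 ^ 2 / s := by positivity
      nlinarith
    have h3 : 0 ≤ s / (1 - ν) := div_nonneg hs0 (by linarith)
    rw [Real.exp_le_exp, div_mul_eq_div_div_swap]
    have h4 : s / (1 - ν) = k.1 ^ 2 / s / (1 - ν) + k.2 ^ 2 / s / (1 - ν) := by
      rw [← add_div, ← add_div, hs]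
    linarith
  have hup : ∀ k : ℝ × ℝ, Ksym ν 1 k ≤ 1 := fun k =>
    (Ksym_one_le hν0 hν1 k).trans (Real.exp_le_one_iff.2 (by linarith [norm_nonneg k]))
  rw [ContinuousAt, Ksym_zero]
  refine tendsto_of_tendsto_of_tendsto_of_le_of_le ?_ tendsto_const_nhds hlow hup
  have : Continuous fun k : ℝ × ℝ => Real.exp (-(√(k.1 ^ 2 + k.2 ^ 2) / (1 - ν))) := by fun_prop
  simpa using this.tendsto 0

/-- The kernel has total mass one, by Fourier inversion at the origin. -/
lemma integral_Kdis_one {ν : ℝ} (hν0 : 0 ≤ ν) (hν1 : ν < 1) :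
    ∫ p : ℝ × ℝ, Kdis ν p.1 p.2 1 = 1 := by
  let ψ : ℂ → ℂ := fun z => (Ksym ν 1 (z.re, z.im) : ℂ)
  have hmp := Complex.volume_preserving_equiv_real_prod
  have hemb := Complex.measurableEquivRealProd.measurableEmbedding
  have hc : (2 * π : ℂ) ^ 2 ≠ 0 := by
    exact_mod_cast (by positivity : ((2 * π) ^ 2 : ℝ) ≠ 0)
  have hψ : Integrable ψ :=
    (hmp.integrable_comp_emb hemb).2 (integrable_Ksym_one hν0 hν1).ofReal
  have hF : ∀ w : ℂ, FourierTransform.fourier ψ w =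
      (2 * π : ℂ) ^ 2 * Kdis ν ((-(2 * π)) • w).re ((-(2 * π)) • w).im 1 := by
    intro w
    rw [Real.fourier_eq', Kdis, ← mul_assoc, mul_one_div_cancel hc, one_mul,
      ← hmp.integral_comp hemb]
    refine integral_congr_ae (ae_of_all _ fun z => ?_)
    simp only [ψ, Complex.measurableEquivRealProd_apply, smul_eq_mul, Complex.inner]
    rw [mul_comm]
    congr 2
    simp
    ring
  have hK : Integrable fun w : ℂ => Kdis ν w.re w.im 1 :=
    (hmp.integrable_comp_emb hemb).2 (integrable_Kdis_one hν0 hν1)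
  have hFi : Integrable (FourierTransform.fourier ψ) := by
    rw [funext hF]
    refine Integrable.const_mul ?_ _
    exact (integrable_comp_smul_iff volume (fun w : ℂ => Kdis ν w.re w.im 1)
      (by simp [Real.pi_ne_zero])).2 hK
  have hcont : ContinuousAt ψ 0 := by
    refine Complex.continuous_ofReal.continuousAt.comp ?_
    have h2 : ContinuousAt (fun z : ℂ => (z.re, z.im)) 0 := by fun_prop
    exact ContinuousAt.comp (f := fun z : ℂ => (z.re, z.im)) (g := Ksym ν 1)
      (continuousAt_Ksym_one_zero hν0 hν1) h2
  have hinv := hψ.fourierInv_fourier_eq hFi hcont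
  have hψ0 : ψ 0 = 1 := by
    exact congrArg Complex.ofReal (Ksym_zero ν 1)
  rw [hψ0, Real.fourierInv_eq'] at hinv
  simp only [inner_zero_right, mul_zero, Complex.ofReal_zero, zero_mul, Complex.exp_zero,
    one_smul, hF] at hinv
  rw [integral_const_mul,
    Measure.integral_comp_smul volume (fun w : ℂ => Kdis ν w.re w.im 1)] at hinv
  rw [← hmp.integral_comp hemb, ← hinv]
  simp only [Complex.measurableEquivRealProd_apply]
  rw [Complex.finrank_real_complex, Complex.real_smul, ← mul_assoc]
  have hone : (2 * π : ℂ) ^ 2 * (|((-(2 * π)) ^ 2)⁻¹| : ℝ) = 1 := by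
    rw [abs_of_nonneg (by positivity), neg_sq]
    push_cast
    exact mul_inv_cancel₀ hc
  rw [hone, one_mul]

lemma Ksym_smul {ν t : ℝ} (ht : 0 < t) (k : ℝ × ℝ) : Ksym ν 1 (t • k) = Ksym ν t k := by
  unfold Ksym
  have hs : √((t * k.1) ^ 2 + (t * k.2) ^ 2) = t * √(k.1 ^ 2 + k.2 ^ 2) := by
    rw [show (t * k.1) ^ 2 + (t * k.2) ^ 2 = t ^ 2 * (k.1 ^ 2 + k.2 ^ 2) by ring,
      Real.sqrt_mul (by positivity), Real.sqrt_sq ht.le]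
  simp only [Prod.smul_fst, Prod.smul_snd, smul_eq_mul, hs]
  congr 1
  rw [div_mul_eq_div_div_swap, div_mul_eq_div_div_swap]
  field_simp

lemma Kdis_smul {ν t : ℝ} (ht : 0 < t) (x y : ℝ) :
    Kdis ν (t * x) (t * y) t = ((t ^ 2)⁻¹ : ℝ) * Kdis ν x y 1 := by
  unfold Kdis
  have h := Measure.integral_comp_smul (volume : Measure (ℝ × ℝ)) (fun k => (Ksym ν 1 k : ℂ) *
    Complex.exp (Complex.I * ((k.1 * x + k.2 * y : ℝ) : ℂ))) t
  rw [Module.finrank_prod, Module.finrank_self, abs_of_pos (by positivity),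
    Complex.real_smul] at h
  rw [mul_left_comm, ← h]
  congr 1
  refine integral_congr_ae (ae_of_all _ fun k => ?_)
  simp only [Ksym_smul ht, Prod.smul_fst, Prod.smul_snd, smul_eq_mul]
  congr 3
  push_cast
  ring

lemma integral_Kdis_mul {ν t : ℝ} (ht : 0 < t) (f : ℝ × ℝ → ℂ) :
    ∫ p : ℝ × ℝ, Kdis ν p.1 p.2 t * f p = ∫ p : ℝ × ℝ, Kdis ν p.1 p.2 1 * f (t • p) := by
  have h := Measure.integral_comp_smul (volume : Measure (ℝ × ℝ))
    (fun p => Kdis ν p.1 p.2 t * f p) t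
  simp only [Prod.smul_fst, Prod.smul_snd, smul_eq_mul, Kdis_smul ht, mul_assoc] at h
  rw [integral_const_mul, Module.finrank_prod, Module.finrank_self, abs_of_pos (by positivity),
    Complex.real_smul] at h
  have ht2 : (((t ^ 2)⁻¹ : ℝ) : ℂ) ≠ 0 := by
    exact_mod_cast (by positivity : (t ^ 2)⁻¹ ≠ 0)
  exact (mul_left_cancel₀ ht2 h).symm

end

theorem kernel_tendsto_delta (ν : ℝ) (hν0 : 0 ≤ ν) (hν1 : ν < 1)
    (f : BoundedContinuousFunction (ℝ × ℝ) ℝ) :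
    Tendsto (fun t : ℝ => ∫ p : ℝ × ℝ, Kdis ν p.1 p.2 t * ((f p : ℝ) : ℂ))
      (nhdsWithin 0 (Set.Ioi 0)) (nhds ((f (0, 0) : ℝ) : ℂ)) := by
  have hK := integrable_Kdis_one hν0 hν1
  have hlim : Tendsto
      (fun t : ℝ => ∫ p : ℝ × ℝ, Kdis ν p.1 p.2 1 * ((f (t • p) : ℝ) : ℂ))
      (𝓝[>] 0) (𝓝 (∫ p : ℝ × ℝ, Kdis ν p.1 p.2 1 * ((f (0, 0) : ℝ) : ℂ))) := by
    refine tendsto_integral_filter_of_dominated_convergence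
      (fun p => ‖Kdis ν p.1 p.2 1‖ * ‖f‖) (Eventually.of_forall fun t => ?_)
      (Eventually.of_forall fun t => ae_of_all _ fun p => ?_) (hK.norm.mul_const _)
      (ae_of_all _ fun p => ?_)
    · refine hK.aestronglyMeasurable.mul (Continuous.aestronglyMeasurable ?_)
      fun_prop
    · rw [norm_mul, Complex.norm_real]
      gcongr
      exact f.norm_coe_le_norm _
    · have hc : Continuous fun t : ℝ => Kdis ν p.1 p.2 1 * ((f (t • p) : ℝ) : ℂ) := by fun_prop
      have := (hc.tendsto 0).mono_left (nhdsWithin_le_nhds (s := Set.Ioi 0))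
      rwa [zero_smul] at this
  rw [integral_mul_const, integral_Kdis_one hν0 hν1, one_mul] at hlim
  refine hlim.congr' ?_
  filter_upwards [self_mem_nhdsWithin] with t ht
  exact (integral_Kdis_mul ht fun p => ((f p : ℝ) : ℂ)).symm
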